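/- Let M < ∞ be a constant. Suppose that for every (n,k) ∈ 𝒯 there exist a feasible online policy π ∈ Π(n,k) and a stopping time τ ≤ n with respect to the filtration (𝓕_t) such that, with j₀ = j₀(n,k): (i) Σ_{j∈[j₀−1]} E[S_j^{π,τ}] = Σ_{j∈[j₀−1]} E[Z_j^τ]; (ii) E[S_{j₀}^{π,τ}] ≥ E[𝔖_{j₀}^τ] − M; (iii) E[S_{j₀+1}^{π,τ}] ≥ E[𝔖_{j₀+1}^τ] − M; and (iv) E[τ] ≥ n − M. Then sup_{(n,k)∈𝒯} {V_off^*(n,k) − V_on^π(n,k)} ≤ 3 a_1 M + a_1/(4ε). -/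

import Mathlib

open MeasureTheory ProbabilityTheory Finset

noncomputable section

namespace MultiSecretary

variable {Ω : Type*}

/-- `Z_j^r`: the number of candidates with ability `aj` among the first `r`
(candidates are indexed `0, 1, …`, so `X 0, …, X (r-1)` are the first `r`). -/
def Zc (X : ℕ → Ω → ℝ) (aj : ℝ) (r : ℕ) (ω : Ω) : ℝ :=
  ∑ t ∈ range r, if X t ω = aj then 1 else 0

/-- `F̄(a_j) = f_1 + ⋯ + f_{j-1}`. -/
def Fbar (f : ℕ → ℝ) (j : ℕ) : ℝ := ∑ i ∈ Icc 1 (j - 1), f i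

/-- The offline-sort count `𝔖_j^r = min { Z_j^r , (k - ∑_{i<j} Z_i^r)_+ }`. -/
def Soff (a : ℕ → ℝ) (X : ℕ → Ω → ℝ) (k r j : ℕ) (ω : Ω) : ℝ :=
  min (Zc X (a j) r ω) (max ((k : ℝ) - ∑ i ∈ Icc 1 (j - 1), Zc X (a i) r ω) 0)

/-- The offline value `V_off^*(n,k) = ∑_j a_j E[𝔖_j^n]`. -/
def Voff [MeasurableSpace Ω] (μ : Measure Ω) (m : ℕ) (a : ℕ → ℝ) (X : ℕ → Ω → ℝ)
    (n k : ℕ) : ℝ :=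
  ∑ j ∈ Icc 1 m, a j * ∫ ω, Soff a X k n j ω ∂μ

/-- The σ-field `𝓕_t` generated by the first `t` pairs `(X_s, U_s)`. -/
def Fil (X U : ℕ → Ω → ℝ) (t : ℕ) : MeasurableSpace Ω :=
  MeasurableSpace.comap (fun ω => fun s : Fin t => (X s ω, U s ω)) inferInstance

/-- A feasible online policy for the `(n,k)` multi-secretary problem: `σp t` is the
(0/1-valued) decision about candidate `t` (0-indexed), measurable with respect to
`𝓕_{t+1} = σ(X_0,U_0,…,X_t,U_t)`, and at most `k` candidates are selected. -/
def IsPolicy (X U : ℕ → Ω → ℝ) (n k : ℕ) (σp : ℕ → Ω → ℕ) : Prop :=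
  (∀ t ω, σp t ω ≤ 1) ∧
  (∀ t, Measurable[Fil X U (t + 1)] (σp t)) ∧
  (∀ ω, ∑ t ∈ range n, σp t ω ≤ k)

/-- The value `V_on^π(n,k)` of an online policy. -/
def Von [MeasurableSpace Ω] (μ : Measure Ω) (X : ℕ → Ω → ℝ) (n : ℕ) (σp : ℕ → Ω → ℕ) : ℝ :=
  ∫ ω, (∑ t ∈ range n, X t ω * (σp t ω : ℝ)) ∂μ

/-- `V_on^*(n,k)`, the optimal value over feasible online policies. -/
def VonStar [MeasurableSpace Ω] (μ : Measure Ω) (X U : ℕ → Ω → ℝ) (n k : ℕ) : ℝ :=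
  sSup {v : ℝ | ∃ σp, IsPolicy X U n k σp ∧ v = Von μ X n σp}

/-- `S_j^{π,r}`: the number of `a_j`-candidates selected by policy `π` among the first `r`. -/
def Spol (a : ℕ → ℝ) (X : ℕ → Ω → ℝ) (σp : ℕ → Ω → ℕ) (j r : ℕ) (ω : Ω) : ℝ :=
  ∑ t ∈ range r, (σp t ω : ℝ) * (if X t ω = a j then 1 else 0)

/-- The Budget-Ratio thresholds: `T_1 = 0`, `T_j = (F̄(a_j)+F̄(a_{j+1}))/2` for `j ≥ 2`. -/
def Tthr (f : ℕ → ℝ) (j : ℕ) : ℝ := if j = 1 then 0 else (Fbar f j + Fbar f (j + 1)) / 2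

/-- The index `j ∈ [m]` with `T_j ≤ x < T_{j+1}` (with `T_{m+1} = ∞`), i.e. the largest
`j ∈ [m]` with `T_j ≤ x`. -/
def jBR (m : ℕ) (f : ℕ → ℝ) (x : ℝ) : ℕ :=
  ((Icc 1 m).filter fun j => Tthr f j ≤ x).sup id

/-- The remaining-budget process `K_t` of the Budget-Ratio policy: `K_0 = k`, and the
candidate `X_t` (presented at time `t+1`, 1-indexed) is selected iff `K_t > 0` and
`X_t > a_{j+1}` where `T_j ≤ K_t/(n-t) < T_{j+1}` (for `j = m`, i.e. `T_m ≤ K_t/(n-t)`,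
every candidate is selected since `T_{m+1} = ∞` and `a_{m+1} < a_m`). -/
def Kbr (m : ℕ) (a f : ℕ → ℝ) (X : ℕ → Ω → ℝ) (n k : ℕ) : ℕ → Ω → ℕ
  | 0, _ => k
  | t + 1, ω =>
    Kbr m a f X n k t ω -
      (if 0 < Kbr m a f X n k t ω ∧
          (jBR m f ((Kbr m a f X n k t ω : ℝ) / ((n : ℝ) - t)) = m ∨
            a (jBR m f ((Kbr m a f X n k t ω : ℝ) / ((n : ℝ) - t)) + 1) < X t ω)
        then 1 else 0)

/-- The selection decisions `σ^br` of the Budget-Ratio policy (0-indexed candidates). -/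
def σbr (m : ℕ) (a f : ℕ → ℝ) (X : ℕ → Ω → ℝ) (n k : ℕ) (t : ℕ) (ω : Ω) : ℕ :=
  Kbr m a f X n k t ω - Kbr m a f X n k (t + 1) ω

/-- The Bernoulli selection indicators `B_t` of a non-adaptive policy `p = (p_{j,t})`. -/
def Bna (m : ℕ) (a : ℕ → ℝ) (p : ℕ → ℕ → ℝ) (X U : ℕ → Ω → ℝ) (t : ℕ) (ω : Ω) : ℝ :=
  ∑ j ∈ Icc 1 m, if U t ω ≤ p j t ∧ X t ω = a j then 1 else 0

/-- The stopping time `ν = min{ r ≥ 1 : B_1 + ⋯ + B_r ≥ k or r ≥ n }` of a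
non-adaptive policy. -/
def nuNA (m : ℕ) (a : ℕ → ℝ) (p : ℕ → ℕ → ℝ) (X U : ℕ → Ω → ℝ) (n k : ℕ) (ω : Ω) : ℕ :=
  sInf {r : ℕ | 1 ≤ r ∧ ((k : ℝ) ≤ ∑ t ∈ range r, Bna m a p X U t ω ∨ n ≤ r)}

/-- The value `V_on^π(n,k) = ∑_j a_j E[∑_{t ≤ ν} B_t 1(X_t = a_j)]` of a non-adaptive policy. -/
def VonNA [MeasurableSpace Ω] (μ : Measure Ω) (m : ℕ) (a : ℕ → ℝ) (p : ℕ → ℕ → ℝ)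
    (X U : ℕ → Ω → ℝ) (n k : ℕ) : ℝ :=
  ∑ j ∈ Icc 1 m, a j *
    ∫ ω, (∑ t ∈ range (nuNA m a p X U n k ω), if X t ω = a j then Bna m a p X U t ω else 0) ∂μ

/-- `V_na^*(n,k)`: the optimal value over non-adaptive policies. -/
def VnaStar [MeasurableSpace Ω] (μ : Measure Ω) (m : ℕ) (a : ℕ → ℝ) (X U : ℕ → Ω → ℝ)
    (n k : ℕ) : ℝ :=
  sSup {v : ℝ | ∃ p : ℕ → ℕ → ℝ,
    (∀ j t, 0 ≤ p j t ∧ p j t ≤ 1) ∧ v = VonNA μ m a p X U n k}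

/-- The deterministic relaxation `DR(n,k)`. -/
def DRval (m : ℕ) (a f : ℕ → ℝ) (n k : ℕ) : ℝ :=
  sSup {v : ℝ | ∃ s : ℕ → ℝ,
    (∀ j ∈ Icc 1 m, 0 ≤ s j ∧ s j ≤ (n : ℝ) * f j) ∧
    (∑ j ∈ Icc 1 m, s j) ≤ (k : ℝ) ∧ v = ∑ j ∈ Icc 1 m, a j * s j}

/-- The optimal solution `s_j^* = min{ n f_j, (k - n F̄(a_j))_+ }` of the deterministic
relaxation. -/
def sStar (f : ℕ → ℝ) (n k j : ℕ) : ℝ :=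
  min ((n : ℝ) * f j) (max ((k : ℝ) - (n : ℝ) * Fbar f j) 0)

/-- `J0Spec m f n k j` says that `j = j₀(n,k)`, the action index of `(n,k)`. -/
def J0Spec (m : ℕ) (f : ℕ → ℝ) (n k j : ℕ) : Prop :=
  (j = 1 ∧ (k : ℝ) / (n : ℝ) < f 1 + f 2 / 2) ∨
  (1 ≤ j ∧ j + 1 ≤ m ∧ Fbar f j + f j / 2 ≤ (k : ℝ) / (n : ℝ) ∧
    (k : ℝ) / (n : ℝ) < Fbar f (j + 2) - f (j + 1) / 2) ∨
  (j = m ∧ 1 - f m / 2 ≤ (k : ℝ) / (n : ℝ))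

/-- The budget ratio `K_t / (n - t)`. -/
def ratio (K : ℕ → Ω → ℕ) (n t : ℕ) (ω : Ω) : ℝ := (K t ω : ℝ) / ((n : ℝ) - t)

/-- The time `τ₀` at which the budget ratio first enters the `δ/2`-orbit of a threshold
(or the deterministic time `n - 2δ⁻¹ - 1` is reached). -/
def tau0 (m : ℕ) (f : ℕ → ℝ) (δ : ℝ) (K : ℕ → Ω → ℕ) (n : ℕ) (ω : Ω) : ℕ :=
  sInf {t : ℕ |
    (∃ j ∈ Icc 1 m, |ratio K n t ω - Tthr f j| ≤ δ / 2) ∨ (n : ℝ) - 2 / δ - 1 ≤ (t : ℝ)}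

/-- The index `j(τ₀)` of the threshold entered at time `τ₀` (set to `m+1`, corresponding to
`T_{j(τ₀)} = ∞`, when `τ₀ ≥ n - 2δ⁻¹ - 1`). -/
def jTau0 (m : ℕ) (f : ℕ → ℝ) (δ : ℝ) (K : ℕ → Ω → ℕ) (n : ℕ) (ω : Ω) : ℕ :=
  if (tau0 m f δ K n ω : ℝ) < (n : ℝ) - 2 / δ - 1 then
    sInf {j : ℕ | j ∈ Icc 1 m ∧ |ratio K n (tau0 m f δ K n ω) ω - Tthr f j| ≤ δ / 2}
  else m + 1

/-- The exit time `τ = inf{ t > τ₀ : |K_t/(n-t) - T_{j(τ₀)}| > δ or t ≥ n - 2δ⁻¹ - 1 }`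
(for `j(τ₀) = m + 1`, i.e. `T_{j(τ₀)} = ∞`, the first condition is vacuous). -/
def tauBR (m : ℕ) (f : ℕ → ℝ) (δ : ℝ) (K : ℕ → Ω → ℕ) (n : ℕ) (ω : Ω) : ℕ :=
  sInf {t : ℕ | tau0 m f δ K n ω < t ∧
    ((n : ℝ) - 2 / δ - 1 ≤ (t : ℝ) ∨
      (jTau0 m f δ K n ω ≤ m ∧ δ < |ratio K n t ω - Tthr f (jTau0 m f δ K n ω)|))}

/-- The deviation process `Y_u = K_{τ₀+u} - T_{j(τ₀)} (n - τ₀ - u)`. -/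
def Ydev (m : ℕ) (f : ℕ → ℝ) (δ : ℝ) (K : ℕ → Ω → ℕ) (n : ℕ) (u : ℕ) (ω : Ω) : ℝ :=
  (K (tau0 m f δ K n ω + u) ω : ℝ) -
    Tthr f (jTau0 m f δ K n ω) * ((n : ℝ) - (tau0 m f δ K n ω : ℝ) - (u : ℝ))

/-- The minimal mass `min{f_1, …, f_m}` of the ability distribution. -/
def minf (m : ℕ) (f : ℕ → ℝ) : ℝ := sInf {x : ℝ | ∃ j, 1 ≤ j ∧ j ≤ m ∧ x = f j}

/-- The standing model hypotheses of the multi-secretary problem: the abilities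
`0 < a_m < ⋯ < a_1`, the probability mass function `f`, and the i.i.d. sequence of
abilities `X_t` together with the auxiliary i.i.d. uniform randomization variables `U_t`. -/
structure Model [MeasurableSpace Ω] (μ : Measure Ω) (m : ℕ) (a f : ℕ → ℝ)
    (X U : ℕ → Ω → ℝ) : Prop where
  hm : 1 ≤ m
  ha_anti : ∀ j, 1 ≤ j → j < m → a (j + 1) < a j
  ha_pos : 0 < a m
  hf_pos : ∀ j, 1 ≤ j → j ≤ m → 0 < f j
  hf_sum : ∑ j ∈ Icc 1 m, f j = 1
  hprob : IsProbabilityMeasure μ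
  hXmeas : ∀ t, Measurable (X t)
  hUmeas : ∀ t, Measurable (U t)
  hXdist : ∀ t j, 1 ≤ j → j ≤ m → μ {ω | X t ω = a j} = ENNReal.ofReal (f j)
  hUdist : ∀ t, μ.map (U t) = volume.restrict (Set.Icc (0 : ℝ) 1)
  hIndep : iIndepFun (fun t ω => (X t ω, U t ω)) μ
  hXUIndep : ∀ t, IndepFun (X t) (U t) μ

/-- The standing model hypotheses with only the ability sequence `X` (no auxiliary
randomization). -/
structure ModelX [MeasurableSpace Ω] (μ : Measure Ω) (m : ℕ) (a f : ℕ → ℝ)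
    (X : ℕ → Ω → ℝ) : Prop where
  hm : 1 ≤ m
  ha_anti : ∀ j, 1 ≤ j → j < m → a (j + 1) < a j
  ha_pos : 0 < a m
  hf_pos : ∀ j, 1 ≤ j → j ≤ m → 0 < f j
  hf_sum : ∑ j ∈ Icc 1 m, f j = 1
  hprob : IsProbabilityMeasure μ
  hXmeas : ∀ t, Measurable (X t)
  hXdist : ∀ t j, 1 ≤ j → j ≤ m → μ {ω | X t ω = a j} = ENNReal.ofReal (f j)
  hIndep : iIndepFun X μ


section Helpers

open scoped Classical

/-- Indicator that candidate `t` has ability `c`. -/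
def indi (X : ℕ → Ω → ℝ) (c : ℝ) (t : ℕ) (ω : Ω) : ℝ := if X t ω = c then 1 else 0

lemma indi_nonneg (X : ℕ → Ω → ℝ) (c : ℝ) (t : ℕ) (ω : Ω) : 0 ≤ indi X c t ω := by
  unfold indi; split_ifs <;> norm_num

lemma indi_le_one (X : ℕ → Ω → ℝ) (c : ℝ) (t : ℕ) (ω : Ω) : indi X c t ω ≤ 1 := by
  unfold indi; split_ifs <;> norm_num

lemma Zc_eq (X : ℕ → Ω → ℝ) (c : ℝ) (r : ℕ) (ω : Ω) :
    Zc X c r ω = ∑ t ∈ range r, indi X c t ω := rfl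

lemma Zc_nonneg (X : ℕ → Ω → ℝ) (c : ℝ) (r : ℕ) (ω : Ω) : 0 ≤ Zc X c r ω :=
  sum_nonneg fun t _ => indi_nonneg X c t ω

lemma Zc_le (X : ℕ → Ω → ℝ) (c : ℝ) (r : ℕ) (ω : Ω) : Zc X c r ω ≤ r := by
  rw [Zc_eq]
  calc _ ≤ ∑ t ∈ range r, (1 : ℝ) := sum_le_sum fun t _ => indi_le_one X c t ω
    _ = r := by simp

lemma Zc_mono (X : ℕ → Ω → ℝ) (c : ℝ) {r n : ℕ} (h : r ≤ n) (ω : Ω) :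
    Zc X c r ω ≤ Zc X c n ω := by
  rw [Zc_eq, Zc_eq]
  exact sum_le_sum_of_subset_of_nonneg (range_mono h) fun t _ _ => indi_nonneg X c t ω

lemma Soff_nonneg (a : ℕ → ℝ) (X : ℕ → Ω → ℝ) (k r j : ℕ) (ω : Ω) : 0 ≤ Soff a X k r j ω :=
  le_min (Zc_nonneg _ _ _ _) (le_max_right _ _)

lemma Soff_le (a : ℕ → ℝ) (X : ℕ → Ω → ℝ) (k r j : ℕ) (ω : Ω) :
    Soff a X k r j ω ≤ Zc X (a j) r ω := min_le_left _ _

lemma Soff_step (a : ℕ → ℝ) (X : ℕ → Ω → ℝ) (k j : ℕ) {r n : ℕ} (h : r ≤ n) (ω : Ω) :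
    Soff a X k n j ω ≤ Soff a X k r j ω + (Zc X (a j) n ω - Zc X (a j) r ω) := by
  have h1 := Zc_mono X (a j) h ω
  have h2 : ∑ i ∈ Icc 1 (j - 1), Zc X (a i) r ω ≤ ∑ i ∈ Icc 1 (j - 1), Zc X (a i) n ω :=
    sum_le_sum fun i _ => Zc_mono X (a i) h ω
  unfold Soff
  set A := ∑ i ∈ Icc 1 (j - 1), Zc X (a i) r ω
  set B := ∑ i ∈ Icc 1 (j - 1), Zc X (a i) n ω
  have h3 : max ((k : ℝ) - B) 0 ≤ max ((k : ℝ) - A) 0 := max_le_max (by linarith) le_rfl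
  rw [← sub_le_iff_le_add]
  refine le_min ?_ ?_
  · have := min_le_left (Zc X (a j) n ω) (max ((k : ℝ) - B) 0); linarith
  · have := min_le_right (Zc X (a j) n ω) (max ((k : ℝ) - B) 0); linarith

lemma Spol_nonneg (a : ℕ → ℝ) (X : ℕ → Ω → ℝ) (σp : ℕ → Ω → ℕ) (j r : ℕ) (ω : Ω) :
    0 ≤ Spol a X σp j r ω :=
  sum_nonneg fun t _ => mul_nonneg (Nat.cast_nonneg _) (indi_nonneg X (a j) t ω)

lemma Spol_le (a : ℕ → ℝ) (X : ℕ → Ω → ℝ) (σp : ℕ → Ω → ℕ) (hσ : ∀ t ω, σp t ω ≤ 1)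
    (j r : ℕ) (ω : Ω) : Spol a X σp j r ω ≤ Zc X (a j) r ω :=
  sum_le_sum fun t _ => by
    have h1 : (σp t ω : ℝ) ≤ 1 := by exact_mod_cast hσ t ω
    have h2 := indi_nonneg X (a j) t ω
    show (σp t ω : ℝ) * indi X (a j) t ω ≤ indi X (a j) t ω
    nlinarith

lemma min_pos_part {z x : ℝ} (hz : 0 ≤ z) : min z (max x 0) = max x 0 - max (x - z) 0 := by
  rcases le_total x 0 with h | h <;> rcases le_total (x - z) 0 with h' | h' <;>
    simp only [max_eq_left, max_eq_right, h, h'] <;>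
    first
      | (rw [min_eq_left (by linarith)]; linarith)
      | (rw [min_eq_right (by linarith)]; linarith)

/-- Telescoping of the offline counts. -/
lemma Soff_tail (a : ℕ → ℝ) (X : ℕ → Ω → ℝ) (k n q : ℕ) (hq : 1 ≤ q) (ω : Ω) (d : ℕ) :
    ∑ j ∈ Ico q (q + d), Soff a X k n j ω
      = max ((k : ℝ) - ∑ i ∈ Icc 1 (q - 1), Zc X (a i) n ω) 0
        - max ((k : ℝ) - ∑ i ∈ Icc 1 (q + d - 1), Zc X (a i) n ω) 0 := by
  induction d with
  | zero => simp
  | succ d ih =>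
    rw [← add_assoc, Finset.sum_Ico_succ_top (by omega), ih]
    unfold Soff
    rw [min_pos_part (Zc_nonneg _ _ _ _)]
    have : ∑ i ∈ Icc 1 (q + d + 1 - 1), Zc X (a i) n ω
        = ∑ i ∈ Icc 1 (q + d - 1), Zc X (a i) n ω + Zc X (a (q + d)) n ω := by
      obtain ⟨p, hp⟩ : ∃ p, q + d = p + 1 := ⟨q + d - 1, by omega⟩
      rw [hp]
      simp only [Nat.add_sub_cancel]
      exact Finset.sum_Icc_succ_top (by omega) _
    rw [this, sub_sub]
    ring

variable [MeasurableSpace Ω]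

lemma integrable_bdd {μ : Measure Ω} [IsFiniteMeasure μ] {g : Ω → ℝ} (hg : Measurable g) (C : ℝ)
    (h0 : ∀ ω, 0 ≤ g ω) (h : ∀ ω, g ω ≤ C) : Integrable g μ :=
  Integrable.of_bound hg.aestronglyMeasurable C
    (Filter.Eventually.of_forall fun ω => by rw [Real.norm_of_nonneg (h0 ω)]; exact h ω)

lemma meas_comp_nat {g : ℕ → Ω → ℝ} (hg : ∀ r, Measurable (g r)) {τ : Ω → ℕ}
    (hτ : Measurable τ) : Measurable fun ω => g (τ ω) ω := by
  have : Measurable (fun p : Ω × ℕ => g p.2 p.1) := measurable_from_prod_countable_left hg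
  exact this.comp (measurable_id.prodMk hτ)

lemma indi_meas {X : ℕ → Ω → ℝ} (hX : ∀ t, Measurable (X t)) (c : ℝ) (t : ℕ) :
    Measurable (indi X c t) :=
  Measurable.ite ((hX t) (measurableSet_singleton c)) measurable_const measurable_const

lemma Zc_meas {X : ℕ → Ω → ℝ} (hX : ∀ t, Measurable (X t)) (c : ℝ) (r : ℕ) :
    Measurable (Zc X c r) :=
  Finset.measurable_fun_sum _ fun t _ => indi_meas hX c t

lemma Soff_meas {X : ℕ → Ω → ℝ} (hX : ∀ t, Measurable (X t)) (a : ℕ → ℝ) (k r j : ℕ) :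
    Measurable (Soff a X k r j) :=
  (Zc_meas hX _ _).min
    ((measurable_const.sub (Finset.measurable_fun_sum _ fun i _ => Zc_meas hX _ _)).max
      measurable_const)

lemma Spol_meas {X : ℕ → Ω → ℝ} (hX : ∀ t, Measurable (X t)) (a : ℕ → ℝ) {σp : ℕ → Ω → ℕ}
    (hσ : ∀ t, Measurable (σp t)) (j r : ℕ) :
    Measurable (Spol a X σp j r) :=
  Finset.measurable_fun_sum _ fun t _ =>
    ((measurable_from_top (f := fun n : ℕ => (n : ℝ))).comp (hσ t)).mul (indi_meas hX _ _)

lemma Fil_le {X U : ℕ → Ω → ℝ} (hX : ∀ t, Measurable (X t)) (hU : ∀ t, Measurable (U t))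
    (t : ℕ) : Fil X U t ≤ (inferInstance : MeasurableSpace Ω) := by
  unfold Fil
  rw [← measurable_iff_comap_le]
  exact measurable_pi_lambda _ fun s => (hX s).prodMk (hU s)

variable {μ : Measure Ω} {m : ℕ} {a f : ℕ → ℝ} {X U : ℕ → Ω → ℝ}

lemma integral_indi (hM : Model μ m a f X U) (t j : ℕ) (h1 : 1 ≤ j) (h2 : j ≤ m) :
    ∫ ω, indi X (a j) t ω ∂μ = f j := by
  have h : indi X (a j) t = Set.indicator {ω | X t ω = a j} 1 := by
    ext ω; simp [indi, Set.indicator]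
  have hms : MeasurableSet {ω | X t ω = a j} := (hM.hXmeas t) (measurableSet_singleton _)
  rw [h, integral_indicator_one hms, Measure.real,
    hM.hXdist t j h1 h2, ENNReal.toReal_ofReal (hM.hf_pos j h1 h2).le]

/-- The past is independent of the present candidate. -/
lemma indep_past (hM : Model μ m a f X U) (t j : ℕ) (h1 : 1 ≤ j) (h2 : j ≤ m) (A : Set Ω)
    (hA : MeasurableSet[Fil X U t] A) :
    μ.real (A ∩ {ω | X t ω = a j}) = f j * μ.real A := by
  have hmeas : ∀ s, Measurable (fun ω => (X s ω, U s ω)) := fun s =>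
    (hM.hXmeas s).prodMk (hM.hUmeas s)
  have hind := hM.hIndep.indepFun_finset (range t) {t} (by simp) hmeas
  obtain ⟨B, hB, rfl⟩ := hA
  let φ : (range t → ℝ × ℝ) → (Fin t → ℝ × ℝ) := fun v s => v ⟨s, by simp⟩
  have hφ : Measurable φ := measurable_pi_lambda _ fun s => measurable_pi_apply _
  let ψ : (({t} : Finset ℕ) → ℝ × ℝ) → ℝ := fun v => (v ⟨t, by simp⟩).1
  have hψ : Measurable ψ := (measurable_pi_apply _).fst
  have hind2 := hind.comp hφ hψ
  have := hind2.measure_inter_preimage_eq_mul B {a j} hB (measurableSet_singleton _)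
  have e : (ψ ∘ fun (ω : Ω) (i : ({t} : Finset ℕ)) => (X i ω, U i ω)) ⁻¹' {a j}
      = {ω | X t ω = a j} := by ext ω; simp [ψ]
  rw [e, hM.hXdist t j h1 h2] at this
  have e2 : (φ ∘ fun (ω : Ω) (i : (range t)) => (X i ω, U i ω)) ⁻¹' B
      = (fun ω => fun s : Fin t => (X s ω, U s ω)) ⁻¹' B := rfl
  rw [e2] at this
  rw [Measure.real, this, ENNReal.toReal_mul, ENNReal.toReal_ofReal (hM.hf_pos j h1 h2).le,
    mul_comm, Measure.real]

/-- Wald's identity for the remaining candidates. -/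
lemma wald (hM : Model μ m a f X U) (j : ℕ) (h1 : 1 ≤ j) (h2 : j ≤ m) (n : ℕ) (τ : Ω → ℕ)
    (hτ : ∀ ω, τ ω ≤ n) (hs : ∀ t, MeasurableSet[Fil X U t] {ω | τ ω ≤ t}) :
    ∫ ω, (Zc X (a j) n ω - Zc X (a j) (τ ω) ω) ∂μ = f j * ∫ ω, ((n : ℝ) - τ ω) ∂μ := by
  have := hM.hprob
  have hms : ∀ t, MeasurableSet {ω | τ ω ≤ t} := fun t => Fil_le hM.hXmeas hM.hUmeas t _ (hs t)
  have hmx : ∀ t, MeasurableSet {ω | X t ω = a j} := fun t =>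
    (hM.hXmeas t) (measurableSet_singleton _)
  have aux : ∀ (g : ℕ → ℝ) (r : ℕ), r ≤ n →
      ∑ t ∈ range n, g t - ∑ t ∈ range r, g t = ∑ t ∈ range n, if r ≤ t then g t else 0 := by
    intro g r hr
    rw [← Finset.sum_filter, ← Finset.sum_Ico_eq_sub _ hr]
    congr 1; ext t; simp; omega
  have e1 : (fun ω => Zc X (a j) n ω - Zc X (a j) (τ ω) ω)
      = fun ω => ∑ t ∈ range n, ({ω | τ ω ≤ t} ∩ {ω | X t ω = a j}).indicator 1 ω := by
    ext ω
    rw [Zc_eq, Zc_eq, aux _ _ (hτ ω)]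
    refine sum_congr rfl fun t _ => ?_
    by_cases hh : τ ω ≤ t <;> by_cases hx : X t ω = a j <;> simp [indi, Set.indicator, hh, hx]
  have e2 : (fun ω => ((n : ℝ) - τ ω))
      = fun ω => ∑ t ∈ range n, ({ω | τ ω ≤ t}).indicator 1 ω := by
    ext ω
    have := aux (fun _ => 1) _ (hτ ω)
    simp only [sum_const, card_range, nsmul_eq_mul, mul_one] at this
    rw [this]
    refine sum_congr rfl fun t _ => ?_
    by_cases hh : τ ω ≤ t <;> simp [Set.indicator, hh]
  rw [e1, e2, integral_finsetSum, integral_finsetSum, mul_sum]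
  · refine sum_congr rfl fun t _ => ?_
    rw [integral_indicator_one ((hms t).inter (hmx t)), integral_indicator_one (hms t)]
    exact indep_past hM t j h1 h2 _ (hs t)
  · exact fun t _ => (integrable_const (1 : ℝ)).indicator (hms t)
  · exact fun t _ => (integrable_const (1 : ℝ)).indicator ((hms t).inter (hmx t))

lemma a_lt (hM : Model μ m a f X U) {i j : ℕ} (h1 : 1 ≤ i) (hij : i < j) (h2 : j ≤ m) :
    a j < a i := by
  induction j, hij using Nat.le_induction with
  | base => exact hM.ha_anti i h1 (by omega)
  | succ j hj ih => exact (hM.ha_anti j (by omega) (by omega)).trans (ih (by omega))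

lemma a_pos (hM : Model μ m a f X U) {i : ℕ} (h1 : 1 ≤ i) (h2 : i ≤ m) : 0 < a i := by
  rcases h2.lt_or_eq with h | h
  · exact hM.ha_pos.trans (a_lt hM h1 h le_rfl)
  · exact h ▸ hM.ha_pos

lemma a_le (hM : Model μ m a f X U) {i : ℕ} (h1 : 1 ≤ i) (h2 : i ≤ m) : a i ≤ a 1 := by
  rcases h1.lt_or_eq with h | h
  · exact (a_lt hM le_rfl h h2).le
  · rw [← h]

lemma sum_indi_le (hM : Model μ m a f X U) {p : ℕ} (hp : p ≤ m) (t : ℕ) (ω : Ω) :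
    ∑ i ∈ Icc 1 p, indi X (a i) t ω ≤ 1 := by
  unfold indi
  rw [← Finset.sum_filter, sum_const, nsmul_eq_mul, mul_one]
  have : #{i ∈ Icc 1 p | X t ω = a i} ≤ 1 := by
    rw [Finset.card_le_one]
    intro i hi j hj
    simp only [mem_filter, mem_Icc] at hi hj
    rcases lt_trichotomy i j with h | h | h
    · have := a_lt hM hi.1.1 h (hj.1.2.trans hp); linarith [hi.2, hj.2]
    · exact h
    · have := a_lt hM hj.1.1 h (hi.1.2.trans hp); linarith [hi.2, hj.2]
  exact_mod_cast this

lemma indi_int (hM : Model μ m a f X U) (c : ℝ) (t : ℕ) : Integrable (indi X c t) μ :=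
  have := hM.hprob
  integrable_bdd (indi_meas hM.hXmeas c t) 1 (indi_nonneg X c t) (indi_le_one X c t)

lemma X_ae (hM : Model μ m a f X U) (t : ℕ) :
    ∀ᵐ ω ∂μ, X t ω = ∑ j ∈ Icc 1 m, a j * indi X (a j) t ω := by
  have := hM.hprob
  have hi : Integrable (fun ω => ∑ j ∈ Icc 1 m, indi X (a j) t ω) μ :=
    integrable_finsetSum _ fun j _ => indi_int hM _ t
  have h0 : ∫ ω, (1 - ∑ j ∈ Icc 1 m, indi X (a j) t ω) ∂μ = 0 := by
    rw [integral_sub (integrable_const _) hi, integral_finsetSum _ fun j _ => indi_int hM _ t,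
      sum_congr rfl fun j hj => integral_indi hM t j (mem_Icc.1 hj).1 (mem_Icc.1 hj).2, hM.hf_sum]
    simp
  rw [integral_eq_zero_iff_of_nonneg
    (fun ω => sub_nonneg.2 (sum_indi_le hM le_rfl t ω)) ((integrable_const _).sub hi)] at h0
  filter_upwards [h0] with ω hω
  have h1 : ∑ j ∈ Icc 1 m, indi X (a j) t ω = 1 := by
    simp only [Pi.zero_apply] at hω; linarith
  calc X t ω = X t ω * ∑ j ∈ Icc 1 m, indi X (a j) t ω := by rw [h1, mul_one]
    _ = _ := by
      rw [mul_sum]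
      refine sum_congr rfl fun j _ => ?_
      unfold indi; split_ifs with h
      · rw [h]
      · simp

lemma Von_ge (hM : Model μ m a f X U) (n k : ℕ) (σp : ℕ → Ω → ℕ) (hp : IsPolicy X U n k σp)
    (τ : Ω → ℕ) (hτ : ∀ ω, τ ω ≤ n) (hτm : Measurable τ) :
    ∑ j ∈ Icc 1 m, a j * ∫ ω, Spol a X σp j (τ ω) ω ∂μ ≤ Von μ X n σp := by
  have := hM.hprob
  have hσ : ∀ t, Measurable (σp t) := fun t =>
    (hp.2.1 t).mono (Fil_le hM.hXmeas hM.hUmeas _) le_rfl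
  have hle : ∀ j r ω, r ≤ n → Spol a X σp j r ω ≤ n := fun j r ω hr =>
    (Spol_le a X σp hp.1 j r ω).trans ((Zc_le _ _ _ _).trans (by exact_mod_cast hr))
  have hi1 : ∀ j, Integrable (fun ω => Spol a X σp j (τ ω) ω) μ := fun j =>
    integrable_bdd (meas_comp_nat (fun r => Spol_meas hM.hXmeas a hσ j r) hτm) n
      (fun ω => Spol_nonneg ..) (fun ω => hle _ _ _ (hτ ω))
  have hi2 : ∀ j, Integrable (fun ω => Spol a X σp j n ω) μ := fun j =>
    integrable_bdd (Spol_meas hM.hXmeas a hσ j n) n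
      (fun ω => Spol_nonneg ..) (fun ω => hle _ _ _ le_rfl)
  have e : Von μ X n σp = ∫ ω, ∑ j ∈ Icc 1 m, a j * Spol a X σp j n ω ∂μ := by
    unfold Von
    refine integral_congr_ae ?_
    filter_upwards [ae_all_iff.2 fun t => X_ae hM t] with ω hω
    simp only [Spol, mul_sum]
    rw [sum_comm]
    refine sum_congr rfl fun t _ => ?_
    conv_lhs => rw [hω t]
    rw [sum_mul]
    refine sum_congr rfl fun j _ => ?_
    unfold indi; ring
  rw [e, integral_finsetSum _ fun j _ => (hi2 j).const_mul _]
  refine sum_le_sum fun j hj => ?_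
  rw [integral_const_mul]
  refine mul_le_mul_of_nonneg_left ?_ (a_pos hM (mem_Icc.1 hj).1 (mem_Icc.1 hj).2).le
  refine integral_mono (hi1 j) (hi2 j) fun ω => ?_
  exact sum_le_sum_of_subset_of_nonneg (range_mono (hτ ω)) fun t _ _ =>
    mul_nonneg (Nat.cast_nonneg _) (indi_nonneg X (a j) t ω)

/-- The tail of the offline solution. -/
lemma tail_bound (hM : Model μ m a f X U) (n k p : ℕ) (hn : 0 < n) (hp : p ≤ m) (ε : ℝ)
    (hε : 0 < ε) (hk : (k : ℝ) ≤ n * (∑ i ∈ Icc 1 p, f i) - n * ε) :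
    ∫ ω, max ((k : ℝ) - ∑ i ∈ Icc 1 p, Zc X (a i) n ω) 0 ∂μ ≤ 1 / (4 * ε) := by
  have := hM.hprob
  let g : ℝ → ℝ := fun x => ∑ i ∈ Icc 1 p, if x = a i then 1 else 0
  have hg : Measurable g := Finset.measurable_fun_sum _ fun i _ =>
    Measurable.ite (measurableSet_singleton _) measurable_const measurable_const
  let Y : ℕ → Ω → ℝ := fun t ω => g (X t ω)
  have hYe : ∀ t ω, Y t ω = ∑ i ∈ Icc 1 p, indi X (a i) t ω := fun t ω => rfl
  have hY0 : ∀ t ω, 0 ≤ Y t ω := fun t ω => sum_nonneg fun i _ => indi_nonneg X (a i) t ω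
  have hY1 : ∀ t ω, Y t ω ≤ 1 := fun t ω => sum_indi_le hM hp t ω
  have hYm : ∀ t, Measurable (Y t) := fun t => hg.comp (hM.hXmeas t)
  have hYL : ∀ t, MemLp (Y t) 2 μ := fun t =>
    MemLp.of_bound (hYm t).aestronglyMeasurable 1
      (Filter.Eventually.of_forall fun ω => by rw [Real.norm_of_nonneg (hY0 t ω)]; exact hY1 t ω)
  have hYi : ∀ t, Integrable (Y t) μ := fun t => integrable_bdd (hYm t) 1 (hY0 t) (hY1 t)
  have hEY : ∀ t, ∫ ω, Y t ω ∂μ = ∑ i ∈ Icc 1 p, f i := by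
    intro t
    simp only [hYe]
    rw [integral_finsetSum _ fun j _ => indi_int hM _ t]
    refine sum_congr rfl fun j hj => integral_indi hM t j (mem_Icc.1 hj).1 ?_
    exact (mem_Icc.1 hj).2.trans hp
  have hind : iIndepFun Y μ := hM.hIndep.comp (fun _ q => g q.1) fun _ => hg.comp measurable_fst
  let B : Ω → ℝ := ∑ t ∈ range n, Y t
  have hBe : ∀ ω, ∑ i ∈ Icc 1 p, Zc X (a i) n ω = B ω := by
    intro ω
    simp only [B, Zc_eq, Finset.sum_apply, hYe]
    rw [sum_comm]
  have hvar : variance B μ ≤ n := by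
    simp only [B]
    rw [IndepFun.variance_sum (fun t _ => hYL t) fun s _ t _ hst => hind.indepFun hst]
    calc _ ≤ ∑ t ∈ range n, (1 : ℝ) := sum_le_sum fun t _ => by
          refine (variance_le_sq_of_bounded (a := 0) (b := 1)
            (Filter.Eventually.of_forall fun ω => ⟨hY0 t ω, hY1 t ω⟩) (hYm t).aemeasurable).trans ?_
          norm_num
      _ = n := by simp
  have hBL : MemLp B 2 μ := memLp_finsetSum' _ fun t _ => hYL t
  set P := ∑ i ∈ Icc 1 p, f i
  have hEB : ∫ ω, B ω ∂μ = n * P := by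
    simp only [B, Finset.sum_apply]
    rw [integral_finsetSum _ fun t _ => hYi t]
    simp [hEY]
  rw [variance_eq_integral hBL.aemeasurable, hEB] at hvar
  have hn' : (0 : ℝ) < n := by exact_mod_cast hn
  have hsq : Integrable (fun ω => (B ω - n * P) ^ 2) μ := (hBL.sub (memLp_const _)).integrable_sq
  have hc : 0 < 4 * (n * ε) := by positivity
  calc _ ≤ ∫ ω, (B ω - n * P) ^ 2 / (4 * (n * ε)) ∂μ := by
        refine integral_mono_of_nonneg (Filter.Eventually.of_forall fun ω => le_max_right _ _)
          (hsq.div_const _) (Filter.Eventually.of_forall fun ω => ?_)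
        simp only [hBe]
        rw [le_div_iff₀ hc]
        rcases le_total ((k : ℝ) - B ω) 0 with h | h
        · rw [max_eq_right h]; simp; positivity
        · rw [max_eq_left h]
          have h2 : (k : ℝ) - B ω ≤ (n * P - B ω) - n * ε := by linarith
          nlinarith [sq_nonneg ((n * P - B ω) - 2 * (n * ε)),
            mul_le_mul_of_nonneg_right h2 hc.le]
    _ = (∫ ω, (B ω - n * P) ^ 2 ∂μ) / (4 * (n * ε)) := integral_div _ _
    _ ≤ n / (4 * (n * ε)) := by gcongr
    _ = 1 / (4 * ε) := by field_simp

lemma minf_le (hM : Model μ m a f X U) (j : ℕ) (h1 : 1 ≤ j) (h2 : j ≤ m) : minf m f ≤ f j := by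
  refine csInf_le ⟨0, ?_⟩ ⟨j, h1, h2, rfl⟩
  rintro x ⟨i, hi1, hi2, rfl⟩
  exact (hM.hf_pos i hi1 hi2).le

lemma minf_pos (hM : Model μ m a f X U) : 0 < minf m f := by
  have hfin : {x : ℝ | ∃ j, 1 ≤ j ∧ j ≤ m ∧ x = f j}.Finite := by
    refine ((Set.finite_Icc 1 m).image f).subset ?_
    rintro x ⟨j, h1, h2, rfl⟩
    exact ⟨j, ⟨h1, h2⟩, rfl⟩
  have hne : {x : ℝ | ∃ j, 1 ≤ j ∧ j ≤ m ∧ x = f j}.Nonempty := ⟨f 1, 1, le_rfl, hM.hm, rfl⟩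
  obtain ⟨j, h1, h2, h⟩ := hne.csInf_mem hfin
  unfold minf
  rw [h]
  exact hM.hf_pos j h1 h2

end Helpers

/-- Proposition 2, a sufficient condition: if for every `(n,k) ∈ 𝒯` there
are a feasible online policy `π(n,k)` and a stopping time `τ(n,k) ≤ n` satisfying conditions
(i)–(iv) with `j₀ = j₀(n,k)` and a common constant `M`, then the regret of the family of
policies is at most `3 a_1 M + a_1/(4ε)` uniformly over `𝒯`. -/
theorem sufficient_condition_for_bounded_regret {Ω : Type*} [MeasurableSpace Ω]
    (μ : Measure Ω) (m : ℕ) (a f : ℕ → ℝ) (X U : ℕ → Ω → ℝ) (hM : Model μ m a f X U)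
    (ε : ℝ) (hε : ε = minf m f / 2)
    (M : ℝ)
    (πf : ℕ → ℕ → ℕ → Ω → ℕ)        -- the policy `π(n,k)`
    (τf : ℕ → ℕ → Ω → ℕ)            -- the stopping time `τ(n,k)`
    (j0f : ℕ → ℕ → ℕ)               -- the action index `j₀(n,k)`
    (hj0 : ∀ n k, 0 < n → k ≤ n → J0Spec m f n k (j0f n k))
    (hpol : ∀ n k, k ≤ n → IsPolicy X U n k (πf n k))
    (hτle : ∀ n k, k ≤ n → ∀ ω, τf n k ω ≤ n)
    (hτstop : ∀ n k, k ≤ n → ∀ t : ℕ, MeasurableSet[Fil X U t] {ω | τf n k ω ≤ t})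
    (hcond₁ : ∀ n k, 0 < n → k ≤ n →
      ∑ j ∈ Icc 1 (j0f n k - 1), ∫ ω, Spol a X (πf n k) j (τf n k ω) ω ∂μ =
        ∑ j ∈ Icc 1 (j0f n k - 1), ∫ ω, Zc X (a j) (τf n k ω) ω ∂μ)
    (hcond₂ : ∀ n k, 0 < n → k ≤ n →
      (∫ ω, Soff a X k (τf n k ω) (j0f n k) ω ∂μ) - M ≤
        ∫ ω, Spol a X (πf n k) (j0f n k) (τf n k ω) ω ∂μ)
    (hcond₃ : ∀ n k, 0 < n → k ≤ n → j0f n k + 1 ≤ m →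
      (∫ ω, Soff a X k (τf n k ω) (j0f n k + 1) ω ∂μ) - M ≤
        ∫ ω, Spol a X (πf n k) (j0f n k + 1) (τf n k ω) ω ∂μ)
    (hcond₄ : ∀ n k : ℕ, 0 < n → k ≤ n → (n : ℝ) - M ≤ ∫ ω, (τf n k ω : ℝ) ∂μ) :
    ∀ n k : ℕ, k ≤ n →
      Voff μ m a X n k - Von μ X n (πf n k) ≤ 3 * a 1 * M + a 1 / (4 * ε) := by
  have := hM.hprob
  have ha1 : 0 < a 1 := a_pos hM le_rfl hM.hm
  have hεpos : 0 < ε := by rw [hε]; exact half_pos (minf_pos hM)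
  have hτm : ∀ n k, k ≤ n → Measurable (τf n k) := fun n k hk =>
    measurable_of_Iic fun t => Fil_le hM.hXmeas hM.hUmeas t _ (hτstop n k hk t)
  have hτi : ∀ n k, k ≤ n → Integrable (fun ω => (τf n k ω : ℝ)) μ := fun n k hk =>
    integrable_bdd (measurable_from_top.comp (hτm n k hk)) n (fun ω => Nat.cast_nonneg _)
      fun ω => by exact_mod_cast hτle n k hk ω
  have hM0 : 0 ≤ M := by
    have h1 := hcond₄ 1 0 one_pos (Nat.zero_le _)
    have h2 : ∫ ω, (τf 1 0 ω : ℝ) ∂μ ≤ ∫ ω, (1 : ℝ) ∂μ :=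
      integral_mono (hτi 1 0 (Nat.zero_le _)) (integrable_const _) fun ω => by
        have := hτle 1 0 (Nat.zero_le _) ω
        show (τf 1 0 ω : ℝ) ≤ 1
        exact_mod_cast this
    simp at h1 h2
    linarith
  intro n k hk
  rcases Nat.eq_zero_or_pos n with rfl | hn
  · have e1 : Voff μ m a X 0 k = 0 := by
      unfold Voff
      refine sum_eq_zero fun j _ => ?_
      have : ∀ ω, Soff a X k 0 j ω = 0 := fun ω =>
        le_antisymm ((Soff_le a X k 0 j ω).trans (by simp [Zc])) (Soff_nonneg ..)
      simp [this]
    have e2 : Von μ X 0 (πf 0 k) = 0 := by simp [Von]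
    rw [e1, e2]
    have : 0 ≤ a 1 / (4 * ε) := by positivity
    have : 0 ≤ 3 * a 1 * M := by positivity
    linarith
  have hτle' := hτle n k hk
  have hτs := hτstop n k hk
  have hτm' := hτm n k hk
  have hτi' := hτi n k hk
  have hp := hpol n k hk
  have hJ := hj0 n k hn hk
  have c1 := hcond₁ n k hn hk
  have c2 := hcond₂ n k hn hk
  have c3 := hcond₃ n k hn hk
  have c4 := hcond₄ n k hn hk
  set τ := τf n k
  set π := πf n k
  set j0 := j0f n k
  have hσ : ∀ t, Measurable (π t) := fun t =>
    (hp.2.1 t).mono (Fil_le hM.hXmeas hM.hUmeas _) le_rfl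
  have hτR : ∀ ω, (τ ω : ℝ) ≤ n := fun ω => by exact_mod_cast hτle' ω
  have iZn : ∀ j, Integrable (fun ω => Zc X (a j) n ω) μ := fun j =>
    integrable_bdd (Zc_meas hM.hXmeas _ _) n (Zc_nonneg X _ _) (Zc_le X _ _)
  have iZτ : ∀ j, Integrable (fun ω => Zc X (a j) (τ ω) ω) μ := fun j =>
    integrable_bdd (meas_comp_nat (Zc_meas hM.hXmeas _) hτm') n (fun ω => Zc_nonneg ..)
      fun ω => (Zc_le ..).trans (hτR ω)
  have iSn : ∀ j, Integrable (fun ω => Soff a X k n j ω) μ := fun j =>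
    integrable_bdd (Soff_meas hM.hXmeas a _ _ _) n (fun ω => Soff_nonneg ..)
      fun ω => (Soff_le ..).trans (Zc_le ..)
  have iSτ : ∀ j, Integrable (fun ω => Soff a X k (τ ω) j ω) μ := fun j =>
    integrable_bdd (meas_comp_nat (g := fun r => Soff a X k r j)
      (fun r => Soff_meas hM.hXmeas a _ _ _) hτm') n (fun ω => Soff_nonneg ..)
      fun ω => (Soff_le ..).trans ((Zc_le ..).trans (hτR ω))
  have iPτ : ∀ j, Integrable (fun ω => Spol a X π j (τ ω) ω) μ := fun j =>
    integrable_bdd (meas_comp_nat (fun r => Spol_meas hM.hXmeas a hσ j r) hτm') n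
      (fun ω => Spol_nonneg ..)
      fun ω => (Spol_le a X π hp.1 _ _ _).trans ((Zc_le ..).trans (hτR ω))
  have hj1 : 1 ≤ j0 := by
    rcases hJ with ⟨h, -⟩ | ⟨h, -⟩ | ⟨h, -⟩
    · omega
    · exact h
    · rw [h]; exact hM.hm
  -- Wald's identity
  have hW : ∀ j, 1 ≤ j → j ≤ m →
      ∫ ω, (Zc X (a j) n ω - Zc X (a j) (τ ω) ω) ∂μ ≤ f j * M := by
    intro j h1 h2
    rw [wald hM j h1 h2 n τ hτle' hτs]
    refine mul_le_mul_of_nonneg_left ?_ (hM.hf_pos j h1 h2).le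
    rw [integral_sub (integrable_const _) hτi']
    simp
    linarith
  have hstep : ∀ j, 1 ≤ j → j ≤ m →
      ∫ ω, Soff a X k n j ω ∂μ ≤ ∫ ω, Soff a X k (τ ω) j ω ∂μ + f j * M := by
    intro j h1 h2
    refine le_trans ?_ (add_le_add_right (hW j h1 h2) _)
    have e : ∫ ω, (Soff a X k (τ ω) j ω + (Zc X (a j) n ω - Zc X (a j) (τ ω) ω)) ∂μ =
        ∫ ω, Soff a X k (τ ω) j ω ∂μ + ∫ ω, (Zc X (a j) n ω - Zc X (a j) (τ ω) ω) ∂μ :=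
      integral_add (iSτ j) ((iZn j).sub (iZτ j))
    rw [← e]
    exact integral_mono (iSn j) ((iSτ j).add ((iZn j).sub (iZτ j)))
      fun ω => Soff_step a X k j (hτle' ω) ω
  have hlow : ∀ j, 1 ≤ j → j ≤ j0 - 1 →
      ∫ ω, Spol a X π j (τ ω) ω ∂μ = ∫ ω, Zc X (a j) (τ ω) ω ∂μ := by
    intro j h1 h2
    refine (sum_eq_sum_iff_of_le fun i _ => ?_).1 c1 j (mem_Icc.2 ⟨h1, h2⟩)
    exact integral_mono (iPτ i) (iZτ i) fun ω => Spol_le a X π hp.1 _ _ _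
  have hd : ∀ j ∈ Icc 1 m, (∫ ω, Soff a X k n j ω ∂μ) - ∫ ω, Spol a X π j (τ ω) ω ∂μ ≤
      f j * M + (if j = j0 then M else 0) + (if j = j0 + 1 then M else 0)
        + (if j0 + 2 ≤ j then ∫ ω, Soff a X k n j ω ∂μ else 0) := by
    intro j hj
    obtain ⟨h1, h2⟩ := mem_Icc.1 hj
    have hs := hstep j h1 h2
    have hfM : 0 ≤ f j * M := mul_nonneg (hM.hf_pos j h1 h2).le hM0
    rcases lt_trichotomy j j0 with h | h | h
    · rw [if_neg (by omega), if_neg (by omega), if_neg (by omega), hlow j h1 (by omega)]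
      have e := hW j h1 h2
      rw [integral_sub (iZn j) (iZτ j)] at e
      have := integral_mono (iSn j) (iZn j) fun ω => Soff_le a X k n j ω
      linarith
    · rw [if_pos h, if_neg (by omega), if_neg (by omega)]
      rw [← h] at c2
      linarith
    · rw [if_neg (by omega)]
      by_cases h' : j = j0 + 1
      · rw [if_pos h', if_neg (by omega)]
        have c3' := c3 (h' ▸ h2)
        rw [← h'] at c3'
        linarith
      · rw [if_neg h', if_pos (by omega)]
        have : 0 ≤ ∫ ω, Spol a X π j (τ ω) ω ∂μ := integral_nonneg fun ω => Spol_nonneg ..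
        linarith
  have htail : ∑ j ∈ Icc 1 m, (if j0 + 2 ≤ j then ∫ ω, Soff a X k n j ω ∂μ else 0)
      ≤ 1 / (4 * ε) := by
    by_cases hjm : j0 + 2 ≤ m
    · obtain ⟨d, hd⟩ : ∃ d, m + 1 = j0 + 2 + d := ⟨m + 1 - (j0 + 2), by omega⟩
      have e : (Icc 1 m).filter (fun j => j0 + 2 ≤ j) = Ico (j0 + 2) (j0 + 2 + d) := by
        ext j; simp; omega
      rw [← sum_filter, e, ← integral_finsetSum _ fun j _ => iSn j]
      have hsum : ∑ i ∈ Icc 1 (j0 + 1), f i = Fbar f (j0 + 2) := rfl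
      have hm' := minf_le hM (j0 + 1) (by omega) (by omega)
      have hkn : (k : ℝ) / n < Fbar f (j0 + 2) - f (j0 + 1) / 2 := by
        rcases hJ with ⟨h, h'⟩ | ⟨-, -, -, h'⟩ | ⟨h, -⟩
        · rw [h]
          have : Fbar f (1 + 2) = f 1 + f 2 := by
            simp [Fbar, show Icc 1 2 = ({1, 2} : Finset ℕ) from rfl]
          rw [this]
          norm_num
          linarith
        · exact h'
        · omega
      have hn' : (0 : ℝ) < n := by exact_mod_cast hn
      refine le_trans ?_ (tail_bound hM n k (j0 + 1) hn (by omega) ε hεpos ?_)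
      · refine integral_mono_of_nonneg
          (Filter.Eventually.of_forall fun ω => sum_nonneg fun j _ => Soff_nonneg ..) ?_
          (Filter.Eventually.of_forall fun ω => ?_)
        · refine integrable_bdd ((measurable_const.sub
            (Finset.measurable_fun_sum _ fun i _ => Zc_meas hM.hXmeas _ _)).max
              measurable_const) k (fun ω => le_max_right _ _) fun ω => max_le ?_ (Nat.cast_nonneg _)
          have : 0 ≤ ∑ i ∈ Icc 1 (j0 + 1), Zc X (a i) n ω := sum_nonneg fun i _ => Zc_nonneg ..
          linarith
        · simp only []
          rw [Soff_tail a X k n (j0 + 2) (by omega) ω d]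
          exact sub_le_self _ (le_max_right _ _)
      · rw [hsum, ← mul_sub]
        rw [div_lt_iff₀ hn'] at hkn
        have : ε ≤ f (j0 + 1) / 2 := by rw [hε]; linarith
        nlinarith
    · rw [sum_eq_zero fun j hj => if_neg (by have := (mem_Icc.1 hj).2; omega)]
      positivity
  have hV := Von_ge hM n k π hp τ hτle' hτm'
  have hind : ∀ q, ∑ j ∈ Icc 1 m, (if j = q then M else 0) ≤ M := by
    intro q
    rw [Finset.sum_ite_eq']
    split_ifs <;> linarith
  calc Voff μ m a X n k - Von μ X n π
      ≤ ∑ j ∈ Icc 1 m, a j * ((∫ ω, Soff a X k n j ω ∂μ) - ∫ ω, Spol a X π j (τ ω) ω ∂μ) := by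
        simp only [mul_sub, sum_sub_distrib]
        unfold Voff
        linarith
    _ ≤ ∑ j ∈ Icc 1 m, a 1 * (f j * M + (if j = j0 then M else 0) + (if j = j0 + 1 then M else 0)
        + (if j0 + 2 ≤ j then ∫ ω, Soff a X k n j ω ∂μ else 0)) := by
        refine sum_le_sum fun j hj => ?_
        obtain ⟨h1, h2⟩ := mem_Icc.1 hj
        refine (mul_le_mul_of_nonneg_left (hd j hj) (a_pos hM h1 h2).le).trans ?_
        refine mul_le_mul_of_nonneg_right (a_le hM h1 h2) ?_
        have hfM : 0 ≤ f j * M := mul_nonneg (hM.hf_pos j h1 h2).le hM0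
        have hI : 0 ≤ ∫ ω, Soff a X k n j ω ∂μ := integral_nonneg fun ω => Soff_nonneg ..
        split_ifs <;> linarith
    _ ≤ a 1 * (M + M + M + 1 / (4 * ε)) := by
        rw [← mul_sum]
        refine mul_le_mul_of_nonneg_left ?_ ha1.le
        simp only [sum_add_distrib]
        rw [← sum_mul, hM.hf_sum, one_mul]
        have := hind j0
        have := hind (j0 + 1)
        linarith
    _ = 3 * a 1 * M + a 1 / (4 * ε) := by ring

end MultiSecretary
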